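/- Let T be a finite tree (connected acyclic simple graph) on a vertex set V, and let B be a symmetric integer matrix indexed by V with B(u,v) = 1 if u, v are adjacent in T and B(u,v) = 0 for distinct non-adjacent u, v, such that −B is positive definite. Then in the ring of multivariate formal power series in variables (y_v)_{v∈V} over the Laurent polynomial ring Z[L, L^{−1}], one has ( Σ_{a ∈ Z_{≥0}^V} [ Σ_{I ⊆ V} (−1)^{|I|} L^{χ(l'_a + E_V) − χ(l'_a + E_{J(a,I)})} ] Π_v y_v^{a_v} ) · Π_{v∈V} (1 − y_v)(1 − L y_v) = (L − 1) · Π_{{u,v} ∈ E(T)} (1 − y_u − y_v + L y_u y_v), where each exponent χ(l'_a + E_V) − χ(l'_a + E_{J(a,I)}) is an integer. (This is the closed formula Z(L,t) = Π_{(u,v)∈E}(1 − t^{E*_u} − t^{E*_v} + L t^{E*_u+E*_v}) / Π_v (1 − t^{E*_v})(1 − L t^{E*_v}) for the motivic series of a tree of rational curves.) -/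

import Mathlib

open Finset

/-- The intersection pairing `(x, y) = xᵀ B y` on `ℚ^V` given by an integer matrix `B`. -/
def pairQ {V : Type*} [Fintype V] (B : V → V → ℤ) (x y : V → ℚ) : ℚ :=
  ∑ i, ∑ j, x i * (B i j : ℚ) * y j

/-- The standard basis vector `e_v`. -/
def basisVec {V : Type*} [DecidableEq V] (v : V) : V → ℚ :=
  fun w => if w = v then 1 else 0

/-- `E_J = ∑_{v ∈ J} e_v` for a subset `J ⊆ V`. -/
def EJ {V : Type*} [DecidableEq V] (J : Finset V) : V → ℚ :=
  fun w => if w ∈ J then 1 else 0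

/-- `χ(x) = -(x, x + K)/2`. -/
def chiQ {V : Type*} [Fintype V] (B : V → V → ℤ) (K : V → ℚ) (x : V → ℚ) : ℚ :=
  -(pairQ B x (x + K)) / 2



section helpers
variable {V : Type*} [Fintype V] [DecidableEq V] (G : SimpleGraph V) [DecidableRel G.Adj]

def nbc (J : Finset V) (v : V) : ℕ := #(J.filter (G.Adj v))

def Clo (S : Finset V) (a : V → ℕ) (J : Finset V) : Prop := ∀ v ∈ S, v ∉ J → nbc G J v ≤ a v

def IsCl (S : Finset V) (a : V → ℕ) (I J : Finset V) : Prop :=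
  I ⊆ J ∧ J ⊆ S ∧ Clo G S a J ∧ ∀ J', I ⊆ J' → J' ⊆ S → Clo G S a J' → J ⊆ J'

open Classical in
noncomputable def cl (S : Finset V) (a : V → ℕ) (I : Finset V) : Finset V :=
  S.filter (fun v => ∀ J', I ⊆ J' → J' ⊆ S → Clo G S a J' → v ∈ J')

def wt (a : V → ℕ) (J : Finset V) : ℤ :=
  ∑ v ∈ J, ((a v : ℤ) + 1) - (∑ i ∈ J, (nbc G J i : ℤ)) / 2

variable {G}


lemma nbc_mono {J J' : Finset V} (h : J ⊆ J') (v : V) : nbc G J v ≤ nbc G J' v :=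
  card_le_card (filter_subset_filter _ h)


lemma nbc_insert {J : Finset V} {u : V} (h : u ∉ J) (v : V) :
    nbc G (insert u J) v = nbc G J v + if G.Adj v u then 1 else 0 := by
  unfold nbc
  rw [filter_insert]
  split_ifs
  · rw [card_insert_of_notMem (by simp [h])]
  · simp


lemma IsCl.unique {S : Finset V} {a : V → ℕ} {I J J' : Finset V}
    (h : IsCl G S a I J) (h' : IsCl G S a I J') : J = J' :=
  Subset.antisymm (h.2.2.2 _ h'.1 h'.2.1 h'.2.2.1) (h'.2.2.2 _ h.1 h.2.1 h.2.2.1)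


lemma isCl_cl {S : Finset V} (a : V → ℕ) {I : Finset V} (hI : I ⊆ S) :
    IsCl G S a I (cl G S a I) := by
  classical
  refine ⟨?_, filter_subset _ _, ?_, ?_⟩
  · intro x hx
    simp only [cl, mem_filter]
    exact ⟨hI hx, fun J' h _ _ => h hx⟩
  · intro v hv hv'
    simp only [cl, mem_filter, not_and, not_forall] at hv'
    obtain ⟨J', h1, h2, h3, h4⟩ := hv' hv
    refine (nbc_mono ?_ v).trans (h3 v hv h4)
    intro x hx
    simp only [cl, mem_filter] at hx
    exact hx.2 _ h1 h2 h3
  · intro J' h1 h2 h3 x hx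
    simp only [cl, mem_filter] at hx
    exact hx.2 _ h1 h2 h3


lemma nbsum_insert {J : Finset V} {u : V} (h : u ∉ J) :
    (∑ i ∈ insert u J, (nbc G (insert u J) i : ℤ)) =
      ∑ i ∈ J, (nbc G J i : ℤ) + 2 * nbc G J u := by
  rw [sum_insert h]
  have : ∀ i ∈ J, (nbc G (insert u J) i : ℤ) = nbc G J i + if G.Adj u i then 1 else 0 := by
    intro i _
    rw [nbc_insert h]
    simp [G.adj_comm i u]
  rw [sum_congr rfl this, sum_add_distrib, nbc_insert h]
  have : (∑ i ∈ J, if G.Adj u i then (1:ℤ) else 0) = nbc G J u := by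
    simp [nbc]
  rw [this]
  simp
  ring


lemma nbsum_even (J : Finset V) : Even (∑ i ∈ J, (nbc G J i : ℤ)) := by
  induction J using Finset.induction_on with
  | empty => simp
  | insert u J h ih =>
    rw [nbsum_insert h]
    exact ih.add (even_two_mul _)


lemma wt_insert (a : V → ℕ) {J : Finset V} {u : V} (h : u ∉ J) :
    wt G a (insert u J) = wt G a J + a u + 1 - nbc G J u := by
  unfold wt
  rw [nbsum_insert h, sum_insert h]
  omega

/-- decrease at `w` -/
def dec (w : V) (a : V → ℕ) : V → ℕ := fun x => a x - if x = w then 1 else 0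


lemma nbc_leaf {S J : Finset V} {u w : V} (hw : ∀ x ∈ S, G.Adj u x ↔ x = w) (hJ : J ⊆ S) :
    nbc G J u = if w ∈ J then 1 else 0 := by
  unfold nbc
  have : J.filter (G.Adj u) = J.filter (fun x => x = w) :=
    filter_congr (fun x hx => hw x (hJ hx))
  rw [this, filter_eq']
  split_ifs <;> simp


lemma nbc_insert_leaf {S J : Finset V} {u w : V} (hu : u ∉ S)
    (hw : ∀ x ∈ S, G.Adj u x ↔ x = w) (hJ : J ⊆ S) {v : V} (hv : v ∈ S) :
    nbc G (insert u J) v = nbc G J v + if v = w then 1 else 0 := by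
  rw [nbc_insert (fun h => hu (hJ h))]
  simp [G.adj_comm v u, hw v hv]


lemma wt_dec (a : V → ℕ) {S J : Finset V} {u w : V} (hu : u ∉ S)
    (hw : ∀ x ∈ S, G.Adj u x ↔ x = w) (hJ : J ⊆ S) (ha : a w ≠ 0) :
    wt G a (insert u J) = wt G (dec w a) J + a u + 1 := by
  rw [wt_insert a (fun h => hu (hJ h)), nbc_leaf hw hJ]
  unfold wt
  have h1 : ∀ v ∈ J, (a v : ℤ) + 1 = ((dec w a v : ℕ) : ℤ) + 1 + if v = w then 1 else 0 := by
    intro v _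
    unfold dec
    split_ifs with h
    · subst h; omega
    · simp
  rw [sum_congr rfl h1, sum_add_distrib (g := fun v => if v = w then (1:ℤ) else 0),
    sum_ite_eq' J w]
  split_ifs <;> simp <;> ring


lemma cl_A1 (a : V → ℕ) {S I : Finset V} {u w : V} (hu : u ∉ S)
    (hw : ∀ x ∈ S, G.Adj u x ↔ x = w) (hI : I ⊆ S) (h : a u ≠ 0 ∨ w ∉ cl G S a I) :
    cl G (insert u S) a I = cl G S a I := by
  obtain ⟨h1, h2, h3, h4⟩ := isCl_cl (G := G) a hI
  refine (isCl_cl a (hI.trans (subset_insert _ _))).unique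
    ⟨h1, h2.trans (subset_insert _ _), ?_, ?_⟩
  · intro v hv hvn
    rcases mem_insert.1 hv with rfl | hv
    · rw [nbc_leaf hw h2]
      split_ifs with h5
      · rcases h with h | h
        · omega
        · exact absurd h5 h
      · omega
    · exact h3 v hv hvn
  · intro J' g1 g2 g3
    refine (h4 (J' ∩ S) (subset_inter g1 hI) inter_subset_right ?_).trans inter_subset_left
    intro v hv hvn
    refine (nbc_mono inter_subset_left v).trans (g3 v (mem_insert_of_mem hv) ?_)
    simpa [hv] using hvn


lemma cl_A2 (a : V → ℕ) {S I : Finset V} {u w : V} (hu : u ∉ S)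
    (hw : ∀ x ∈ S, G.Adj u x ↔ x = w) (hI : I ⊆ S) (h : a u = 0) (h' : w ∈ cl G S a I) :
    cl G (insert u S) a I = insert u (cl G S a I) := by
  obtain ⟨h1, h2, h3, h4⟩ := isCl_cl (G := G) a hI
  refine (isCl_cl a (hI.trans (subset_insert _ _))).unique
    ⟨h1.trans (subset_insert _ _), insert_subset_insert _ h2, ?_, ?_⟩
  · intro v hv hvn
    simp only [mem_insert, not_or] at hvn
    have hv : v ∈ S := by simpa [hvn.1] using hv
    rw [nbc_insert_leaf hu hw h2 hv, if_neg]
    · exact h3 v hv hvn.2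
    · rintro rfl; exact hvn.2 h'
  · intro J' g1 g2 g3
    have key : cl G S a I ⊆ J' := by
      refine (h4 (J' ∩ S) (subset_inter g1 hI) inter_subset_right ?_).trans inter_subset_left
      intro v hv hvn
      refine (nbc_mono inter_subset_left v).trans (g3 v (mem_insert_of_mem hv) ?_)
      simpa [hv] using hvn
    refine insert_subset ?_ key
    by_contra hun
    have h5 := g3 u (mem_insert_self _ _) hun
    have h6 := nbc_mono (G := G) key u
    rw [nbc_leaf hw h2, if_pos h'] at h6
    omega


lemma cl_B (a : V → ℕ) {S I : Finset V} {u w : V} (hu : u ∉ S)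
    (hw : ∀ x ∈ S, G.Adj u x ↔ x = w) (hI : I ⊆ S) (ha : a w ≠ 0) :
    cl G (insert u S) a (insert u I) = insert u (cl G S (dec w a) I) := by
  obtain ⟨h1, h2, h3, h4⟩ := isCl_cl (G := G) (dec w a) hI
  refine (isCl_cl a (insert_subset_insert _ hI)).unique
    ⟨insert_subset_insert _ h1, insert_subset_insert _ h2, ?_, ?_⟩
  · intro v hv hvn
    simp only [mem_insert, not_or] at hvn
    have hv : v ∈ S := by simpa [hvn.1] using hv
    rw [nbc_insert_leaf hu hw h2 hv]
    have := h3 v hv hvn.2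
    rw [show dec w a v = a v - if v = w then 1 else 0 from rfl] at this
    split_ifs at this ⊢ with h
    · subst h; omega
    · omega
  · intro J' g1 g2 g3
    have huJ : u ∈ J' := g1 (mem_insert_self _ _)
    refine insert_subset huJ ?_
    refine (h4 (J' ∩ S) (subset_inter ((subset_insert _ _).trans g1) hI) inter_subset_right
      ?_).trans inter_subset_left
    intro v hv hvn
    have h5 := g3 v (mem_insert_of_mem hv) (by simpa [hv] using hvn)
    have h6 := nbc_mono (G := G) (insert_subset huJ (inter_subset_left (s₁ := J') (s₂ := S))) v
    rw [nbc_insert_leaf hu hw inter_subset_right hv] at h6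
    unfold dec
    omega


lemma cl_C (a : V → ℕ) {S I : Finset V} {u w : V}
    (hw : ∀ x ∈ S, G.Adj u x ↔ x = w) (hwS : w ∈ S) (hI : I ⊆ S) (ha : a w = 0) :
    cl G (insert u S) a (insert u (insert w I)) = cl G (insert u S) a (insert u I) := by
  obtain ⟨h1, h2, h3, h4⟩ := isCl_cl (G := G) a
    (insert_subset_insert u (insert_subset hwS hI))
  refine IsCl.unique ⟨(insert_subset_insert _ (subset_insert _ _)).trans h1, h2, h3, ?_⟩
    (isCl_cl a (insert_subset_insert u hI))
  intro J' g1 g2 g3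
  refine h4 J' ?_ g2 g3
  have huJ : u ∈ J' := g1 (mem_insert_self _ _)
  refine insert_subset huJ (insert_subset ?_ ((subset_insert _ _).trans g1))
  by_contra hwn
  have h5 := g3 w (mem_insert_of_mem hwS) hwn
  have : 0 < nbc G J' w := by
    refine card_pos.2 ⟨u, ?_⟩
    simp [huJ, G.adj_comm w u, hw w hwS]
  omega

variable (G)
open LaurentPolynomial in
noncomputable def FF (S : Finset V) (a : V → ℕ) : LaurentPolynomial ℤ :=
  ∑ I ∈ S.powerset, (-1 : LaurentPolynomial ℤ) ^ I.card *
    LaurentPolynomial.T (wt G a S - wt G a (cl G S a I))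
variable {G}


lemma FF_rec (a : V → ℕ) {S : Finset V} {u w : V} (hu : u ∉ S)
    (hw : ∀ x ∈ S, G.Adj u x ↔ x = w) (hwS : w ∈ S) :
    FF G (insert u S) a = LaurentPolynomial.T (a u) * FF G S a -
      if a w = 0 then 0 else FF G S (dec w a) := by
  unfold FF
  rw [sum_powerset_insert hu, sub_eq_add_neg]
  congr 1
  · rw [mul_sum]
    refine sum_congr rfl fun I hI => ?_
    have hI := mem_powerset.1 hI
    rw [mul_left_comm, ← LaurentPolynomial.T_add]
    congr 2
    have h2 := (isCl_cl (G := G) a hI).2.1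
    rw [wt_insert a hu, nbc_leaf hw (Subset.refl S), if_pos hwS]
    by_cases h : a u ≠ 0 ∨ w ∉ cl G S a I
    · rw [cl_A1 a hu hw hI h]
      push_cast; ring
    · push Not at h
      rw [cl_A2 a hu hw hI h.1 h.2, wt_insert a (fun h => hu (h2 h)), nbc_leaf hw h2, if_pos h.2,
        h.1]
      push_cast; ring
  · split_ifs with ha
    · rw [neg_zero]
      obtain ⟨R, hR, rfl⟩ : ∃ R, w ∉ R ∧ S = insert w R :=
        ⟨S.erase w, by simp, by rw [insert_erase hwS]⟩
      rw [sum_powerset_insert hR, ← sum_add_distrib]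
      refine sum_eq_zero fun I hI => ?_
      have hI := mem_powerset.1 hI
      rw [cl_C a hw hwS (hI.trans (subset_insert _ _)) ha]
      have hui : u ∉ insert w I := fun h => hu (insert_subset_insert _ hI h)
      rw [card_insert_of_notMem hui, card_insert_of_notMem (fun h => hR (hI h)),
        card_insert_of_notMem (fun h => hui (mem_insert_of_mem h))]
      ring
    · rw [← sum_neg_distrib]
      refine sum_congr rfl fun I hI => ?_
      have hI := mem_powerset.1 hI
      have h2 := (isCl_cl (G := G) (dec w a) hI).2.1
      rw [cl_B a hu hw hI ha, wt_dec a hu hw (Subset.refl S) ha, wt_dec a hu hw h2 ha,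
        card_insert_of_notMem (fun h => hu (hI h))]
      rw [show ∀ x y z : ℤ, x + z + 1 - (y + z + 1) = x - y by intros; ring]
      ring


lemma FF_single (a : V → ℕ) (r : V) :
    FF G {r} a = LaurentPolynomial.T (a r) * LaurentPolynomial.T 1 - 1 := by
  have e1 : cl G {r} a ∅ = ∅ := by
    refine (isCl_cl a (by simp)).unique ⟨by simp, by simp, ?_, by simp⟩
    intro v _ _
    simp [nbc]
  have e2 : cl G {r} a {r} = {r} := by
    refine (isCl_cl a (by simp)).unique ⟨by simp, by simp, ?_, fun J' h _ _ => h⟩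
    intro v h h'
    exact absurd h h'
  have e3 := wt_insert (G := G) a (notMem_empty r)
  have e4 : wt G a ∅ = 0 := by simp [wt]
  have e5 : nbc G ∅ r = 0 := by simp [nbc]
  rw [e4, e5] at e3
  unfold FF
  rw [← insert_empty, sum_powerset_insert (notMem_empty r)]
  simp only [powerset_empty, sum_singleton, insert_empty] at *
  rw [e1, e2, e3, e4, ← LaurentPolynomial.T_add]
  simp [LaurentPolynomial.T_zero]
  ring

abbrev PS (V : Type*) := MvPowerSeries V (LaurentPolynomial ℤ)

noncomputable def LL (V : Type*) : PS V := MvPowerSeries.C (LaurentPolynomial.T 1)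


lemma coeff_X_mul' (u : V) (f : PS V) (a : V →₀ ℕ) :
    MvPowerSeries.coeff a (MvPowerSeries.X u * f) =
      if a u = 0 then 0 else MvPowerSeries.coeff (a - Finsupp.single u 1) f := by
  rw [MvPowerSeries.X, MvPowerSeries.coeff_monomial_mul]
  simp only [Finsupp.single_le_iff, one_mul]
  split_ifs <;> first | rfl | omega

noncomputable def ser (f : (V → ℕ) → LaurentPolynomial ℤ) : PS V := fun a => f a


lemma coeff_ser (f : (V → ℕ) → LaurentPolynomial ℤ) (a : V →₀ ℕ) :
    MvPowerSeries.coeff a (ser f) = f a := rfl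


lemma dec_coe (w : V) (a : V →₀ ℕ) : ((a - Finsupp.single w 1 : V →₀ ℕ) : V → ℕ) = dec w a := by
  ext x
  simp [dec, Finsupp.single_apply, eq_comm]

/-- if `f` does not depend on `u`. -/
lemma ser_geom (f : (V → ℕ) → LaurentPolynomial ℤ) (u : V)
    (hf : ∀ a, f (dec u a) = f a) :
    ser (fun a => LaurentPolynomial.T (a u) * f a) * (1 - LL V * MvPowerSeries.X u) =
      ser f * (1 - MvPowerSeries.X u) := by
  ext1 a
  rw [show ∀ x y z : PS V, x * (1 - y * z) = x - y * (z * x) by intros; ring,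
    show ∀ x z : PS V, x * (1 - z) = x - (z * x) by intros; ring]
  simp only [map_sub, LL, MvPowerSeries.coeff_C_mul, coeff_X_mul', coeff_ser, dec_coe, hf]
  split_ifs with h
  · simp [h]
  · rw [← mul_assoc, ← LaurentPolynomial.T_add]
    have : (1 : ℤ) + (dec u a u : ℕ) = a u := by
      simp only [dec, if_true]; omega
    rw [this]; simp

lemma FF_dec (S : Finset V) (u : V) (hu : u ∉ S) (a : V → ℕ) :
    FF G S (dec u a) = FF G S a := by
  have h : ∀ x ∈ S, dec u a x = a x := by
    intro x hx
    have : x ≠ u := by rintro rfl; exact hu hx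
    simp [dec, this]
  have hcl : ∀ J, Clo G S (dec u a) J ↔ Clo G S a J := by
    intro J
    refine forall_congr' fun v => ⟨fun g h1 => ?_, fun g h1 => ?_⟩
    · rw [← h v h1]; exact g h1
    · rw [h v h1]; exact g h1
  have hc : ∀ I, cl G S (dec u a) I = cl G S a I := by
    intro I; ext v; simp only [cl, hcl, mem_filter]
  have hwt : ∀ J, J ⊆ S → wt G (dec u a) J = wt G a J := by
    intro J hJ
    unfold wt
    rw [sum_congr rfl fun v hv => by rw [h v (hJ hv)]]
  unfold FF
  refine sum_congr rfl fun I hI => ?_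
  rw [hc, hwt S subset_rfl, hwt _ (isCl_cl a (mem_powerset.1 hI)).2.1]

lemma ones_mul : ser (fun _ : V → ℕ => (1 : LaurentPolynomial ℤ)) *
    ∏ v : V, (1 - MvPowerSeries.X v) = 1 := by
  have : ∀ S : Finset V, ser (fun _ : V → ℕ => (1 : LaurentPolynomial ℤ)) *
    ∏ v ∈ S, (1 - MvPowerSeries.X v) =
      ser (fun a : V → ℕ => if ∀ v ∈ S, a v = 0 then (1 : LaurentPolynomial ℤ) else 0) := by
    intro S
    induction S using Finset.induction_on with
    | empty => simp
    | insert u S hu ih =>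
      rw [prod_insert hu, mul_left_comm, ih]
      ext1 a
      rw [sub_mul, one_mul, map_sub, coeff_X_mul']
      simp only [coeff_ser, dec_coe]
      have : (∀ v ∈ S, dec u a v = 0) ↔ (∀ v ∈ S, a v = 0) := by
        refine forall_congr' fun v => forall_congr' fun hv => ?_
        have : v ≠ u := by rintro rfl; exact hu hv
        simp [dec, this]
      simp only [this, forall_mem_insert]
      split_ifs <;> simp_all
  rw [this]
  ext1 a
  rw [coeff_ser, MvPowerSeries.coeff_one]
  simp [Finsupp.ext_iff]

noncomputable def edgeF (V : Type*) (e : Sym2 V) : PS V :=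
  Sym2.lift ⟨fun u v => 1 - MvPowerSeries.X u - MvPowerSeries.X v +
            MvPowerSeries.C (σ := V) (R := LaurentPolynomial ℤ) (LaurentPolynomial.T 1) *
              MvPowerSeries.X u * MvPowerSeries.X v,
          by intro u v; simp only []; ring⟩ e

variable (G)
/-- edges inside `S` -/
def edgesIn (S : Finset V) : Finset (Sym2 V) := G.edgeFinset.filter (fun e => ∀ x ∈ e, x ∈ S)

def Good (S : Finset V) : Prop :=
  ser (FF G S) * ((∏ v ∈ S, (1 - LL V * MvPowerSeries.X v)) * ∏ v : V, (1 - MvPowerSeries.X v)) =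
    (LL V - 1) * ∏ e ∈ edgesIn G S, edgeF V e
variable {G}

lemma good_single (r : V) : Good G {r} := by
  have h1 : edgesIn G {r} = ∅ := by
    unfold edgesIn
    refine filter_eq_empty_iff.2 ?_
    intro e he h
    induction e using Sym2.ind with
    | _ x y =>
      have hx := h x (by simp)
      have hy := h y (by simp)
      simp only [mem_singleton] at hx hy
      subst hx; subst hy
      simp at he
  unfold Good
  rw [h1, prod_empty, prod_singleton, mul_one]
  have h2 := ser_geom (fun _ => 1) r (fun _ => rfl)
  have h3 : ser (FF G {r}) = LL V * ser (fun a => LaurentPolynomial.T (a r) * 1) -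
      ser (fun _ => 1) := by
    ext1 a
    rw [map_sub, LL, MvPowerSeries.coeff_C_mul]
    simp only [coeff_ser, FF_single]
    ring
  rw [h3]
  calc _ = (LL V * (ser (fun a => LaurentPolynomial.T (a r) * 1) * (1 - LL V * MvPowerSeries.X r))
      - ser (fun _ => 1) * (1 - LL V * MvPowerSeries.X r)) * ∏ v : V, (1 - MvPowerSeries.X v) := by
        ring
    _ = (LL V - 1) * (ser (fun _ => 1) * ∏ v : V, (1 - MvPowerSeries.X v)) := by
        rw [h2]; ring
    _ = _ := by rw [ones_mul, mul_one]

set_option maxHeartbeats 1000000 in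
lemma good_insert {S : Finset V} {u w : V} (hu : u ∉ S)
    (hw : ∀ x ∈ S, G.Adj u x ↔ x = w) (hwS : w ∈ S) (hS : Good G S) : Good G (insert u S) := by
  have h1 : edgesIn G (insert u S) = insert s(u, w) (edgesIn G S) := by
    have := hw w hwS
    ext e
    induction e using Sym2.ind with
    | _ x y =>
      simp only [edgesIn, mem_filter, SimpleGraph.mem_edgeFinset, SimpleGraph.mem_edgeSet,
        Sym2.mem_iff, forall_eq_or_imp, forall_eq, mem_insert, Sym2.eq_iff]
      constructor
      · rintro ⟨h, rfl | hx, rfl | hy⟩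
        · exact absurd h (G.loopless.irrefl _)
        · exact Or.inl (Or.inl ⟨rfl, (hw y hy).1 h⟩)
        · exact Or.inl (Or.inr ⟨(hw x hx).1 h.symm, rfl⟩)
        · exact Or.inr ⟨h, hx, hy⟩
      · rintro ((⟨rfl, rfl⟩ | ⟨rfl, rfl⟩) | ⟨h, hx, hy⟩)
        · exact ⟨this.2 rfl, Or.inl rfl, Or.inr hwS⟩
        · exact ⟨(this.2 rfl).symm, Or.inr hwS, Or.inl rfl⟩
        · exact ⟨h, Or.inr hx, Or.inr hy⟩
  have h2 : s(u, w) ∉ edgesIn G S := by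
    simp [edgesIn, hu]
  unfold Good at *
  rw [h1, prod_insert h2, prod_insert hu]
  have h3 := ser_geom (FF G S) u (FF_dec S u hu)
  have h4 : ser (FF G (insert u S)) = ser (fun a => LaurentPolynomial.T (a u) * FF G S a) -
      MvPowerSeries.X w * ser (FF G S) := by
    ext1 a
    rw [map_sub, coeff_X_mul']
    simp only [coeff_ser, dec_coe]
    exact FF_rec _ hu hw hwS
  have h5 : edgeF V s(u, w) = 1 - MvPowerSeries.X u - MvPowerSeries.X w +
      LL V * MvPowerSeries.X u * MvPowerSeries.X w := rfl
  rw [h4, h5]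
  calc _ = (ser (fun a => LaurentPolynomial.T (a u) * FF G S a) * (1 - LL V * MvPowerSeries.X u)
        - MvPowerSeries.X w * ser (FF G S) * (1 - LL V * MvPowerSeries.X u)) *
        ((∏ v ∈ S, (1 - LL V * MvPowerSeries.X v)) * ∏ v : V, (1 - MvPowerSeries.X v)) := by ring
    _ = (1 - MvPowerSeries.X u - MvPowerSeries.X w +
      LL V * MvPowerSeries.X u * MvPowerSeries.X w) * (ser (FF G S) *
        ((∏ v ∈ S, (1 - LL V * MvPowerSeries.X v)) * ∏ v : V, (1 - MvPowerSeries.X v))) := by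
      rw [h3]; ring
    _ = _ := by rw [hS]; ring

def ConnIn (G : SimpleGraph V) (S : Finset V) : Prop :=
  ∀ x ∈ S, ∀ y ∈ S, ∃ p : G.Walk x y, ∀ z ∈ p.support, z ∈ S

lemma good_univ (hT : G.IsTree) : Good G univ := by
  classical
  obtain ⟨r⟩ := hT.1.nonempty
  let P : Finset V → Prop := fun S => S.Nonempty ∧ ConnIn G S ∧ Good G S
  have hne : ((univ : Finset (Finset V)).filter P).Nonempty := by
    refine ⟨{r}, ?_⟩
    simp only [mem_filter, mem_univ, true_and, P]
    refine ⟨by simp, ?_, good_single r⟩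
    intro x hx y hy
    rw [mem_singleton] at hx hy
    subst hx; subst hy
    exact ⟨.nil, by simp⟩
  obtain ⟨S, hS, hmax⟩ := exists_max_image _ card hne
  simp only [mem_filter, mem_univ, true_and, P] at hS hmax
  obtain ⟨⟨r, hr⟩, hconn, hgood⟩ := hS
  by_cases hSu : S = univ
  · rwa [hSu] at hgood
  exfalso
  obtain ⟨t, ht⟩ : ∃ t, t ∉ S := by
    by_contra! h
    exact hSu (eq_univ_iff_forall.2 h)
  obtain ⟨p⟩ := hT.1.preconnected r t
  obtain ⟨d, -, hd1, hd2⟩ := p.exists_boundary_dart (S : Set V) (by simpa using hr) (by simpa using ht)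
  obtain ⟨⟨w, u⟩, hadj⟩ := d
  simp only [mem_coe] at hd1 hd2 hadj
  have hw : ∀ x ∈ S, G.Adj u x ↔ x = w := by
    intro x hx
    refine ⟨fun h => ?_, by rintro rfl; exact hadj.symm⟩
    by_contra hne
    obtain ⟨q, hq⟩ := hconn w hd1 x hx
    have hq' : u ∉ q.toPath.1.support := fun h' =>
      hd2 (hq _ (SimpleGraph.Walk.support_toPath_subset q h'))
    let q2 : G.Walk w x := .cons hadj (.cons h .nil)
    have hq2 : q2.IsPath := by
      have h1 := hadj.ne
      have h2 := h.ne
      simp [q2, h1, h2, Ne.symm hne]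
    have := hT.2.path_unique q.toPath ⟨q2, hq2⟩
    rw [this] at hq'
    apply hq'
    simp [q2]
  have hP : P (insert u S) := by
    refine ⟨by simp, ?_, good_insert hd2 hw hd1 hgood⟩
    have key : ∀ x ∈ insert u S, ∃ p : G.Walk w x, ∀ z ∈ p.support, z ∈ insert u S := by
      intro x hx
      rcases mem_insert.1 hx with rfl | hx
      · refine ⟨.cons hadj .nil, ?_⟩
        simp [hd1]
      · obtain ⟨p, hp⟩ := hconn w hd1 x hx
        exact ⟨p, fun z hz => mem_insert_of_mem (hp z hz)⟩
    intro x hx y hy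
    obtain ⟨p, hp⟩ := key x hx
    obtain ⟨q, hq⟩ := key y hy
    refine ⟨p.reverse.append q, ?_⟩
    intro z hz
    rw [SimpleGraph.Walk.mem_support_append_iff] at hz
    rcases hz with hz | hz
    · exact hp z (by simpa using hz)
    · exact hq z hz
  have := hmax _ hP
  rw [card_insert_of_notMem hd2] at this
  omega

section pairing
variable (B : V → V → ℤ)

lemma pairQ_add_left (x y z : V → ℚ) : pairQ B (x + y) z = pairQ B x z + pairQ B y z := by
  simp only [pairQ, Pi.add_apply, add_mul, sum_add_distrib]

lemma pairQ_add_right (x y z : V → ℚ) : pairQ B x (y + z) = pairQ B x y + pairQ B x z := by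
  simp only [pairQ, Pi.add_apply, mul_add, sum_add_distrib]

variable {B}
lemma pairQ_comm (hB : ∀ u v, B u v = B v u) (x y : V → ℚ) : pairQ B x y = pairQ B y x := by
  unfold pairQ
  rw [sum_comm]
  refine sum_congr rfl fun i _ => sum_congr rfl fun j _ => ?_
  rw [hB]; ring

lemma pairQ_basis (x : V → ℚ) (v : V) : pairQ B x (basisVec v) = ∑ i, x i * (B i v : ℚ) := by
  simp [pairQ, basisVec]

lemma pairQ_EJ (x : V → ℚ) (J : Finset V) :
    pairQ B x (EJ J) = ∑ v ∈ J, pairQ B x (basisVec v) := by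
  simp only [pairQ_basis]
  rw [sum_comm]
  simp [pairQ, EJ]

lemma pairQ_EJ_basis (hBadj : ∀ u v, G.Adj u v → B u v = 1)
    (hBnon : ∀ u v, u ≠ v → ¬ G.Adj u v → B u v = 0) (hB : ∀ u v, B u v = B v u)
    (J : Finset V) (v : V) :
    pairQ B (EJ J) (basisVec v) = nbc G J v + if v ∈ J then (B v v : ℚ) else 0 := by
  rw [pairQ_basis]
  have h1 : ∀ i, EJ J i * (B i v : ℚ) = (if i ∈ J then if G.Adj v i then 1 else 0 else 0) +
      if i = v then (if v ∈ J then (B v v : ℚ) else 0) else 0 := by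
    intro i
    unfold EJ
    by_cases hiv : i = v
    · subst hiv; simp
    · by_cases hadj : G.Adj v i
      · simp [hiv, hadj, hBadj i v hadj.symm]
      · simp [hiv, hadj, hBnon i v hiv (fun h => hadj h.symm)]
  rw [sum_congr rfl fun i _ => h1 i, sum_add_distrib]
  simp [nbc]

lemma chi_eq (hBadj : ∀ u v, G.Adj u v → B u v = 1)
    (hBnon : ∀ u v, u ≠ v → ¬ G.Adj u v → B u v = 0) (hB : ∀ u v, B u v = B v u)
    (K : V → ℚ) (hK : ∀ v, pairQ B (K + basisVec v) (basisVec v) = -2)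
    (l : V → ℚ) (a : V → ℕ) (hl : ∀ v, pairQ B l (basisVec v) = -(a v : ℚ)) (J : Finset V) :
    chiQ B K (l + EJ J) = - pairQ B l (l + K) / 2 + wt G a J := by
  have hK' : ∀ v, pairQ B K (basisVec v) = -2 - B v v := by
    intro v
    have h1 := hK v
    rw [pairQ_add_left, pairQ_basis (basisVec v)] at h1
    simp [basisVec] at h1
    linarith
  obtain ⟨k, hk⟩ := nbsum_even (G := G) J
  have hk' : (∑ i ∈ J, (nbc G J i : ℚ)) = k + k := by exact_mod_cast hk
  have hwt : (wt G a J : ℚ) = ∑ v ∈ J, ((a v : ℚ) + 1) - k := by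
    unfold wt
    rw [hk, show (k + k) / 2 = k by omega]
    push_cast; rfl
  have e1 : pairQ B (EJ J) (EJ J) = (k + k) + ∑ v ∈ J, (B v v : ℚ) := by
    rw [pairQ_EJ, ← hk', ← sum_add_distrib]
    refine sum_congr rfl fun v hv => ?_
    rw [pairQ_EJ_basis hBadj hBnon hB, if_pos hv]
  have e2 : pairQ B l (EJ J) = - ∑ v ∈ J, (a v : ℚ) := by
    rw [pairQ_EJ, ← sum_neg_distrib]
    exact sum_congr rfl fun v _ => hl v
  have e3 : pairQ B K (EJ J) = - ∑ v ∈ J, (2 : ℚ) - ∑ v ∈ J, (B v v : ℚ) := by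
    rw [pairQ_EJ, ← sum_neg_distrib, ← sum_sub_distrib]
    exact sum_congr rfl fun v _ => hK' v
  rw [hwt, chiQ]
  simp only [pairQ_add_left, pairQ_add_right]
  rw [pairQ_comm hB (EJ J) l, pairQ_comm hB (EJ J) K, e1, e2, e3, sum_add_distrib]
  simp only [sum_const, nsmul_eq_mul]
  ring

end pairing

end helpers

/-- **The closed formula for the motivic series `Z(L,t)` of a tree of rational curves.**
In `ℤ[L,L⁻¹][[y_v : v ∈ V]]`,
`(∑_a [∑_{I ⊆ V} (-1)^{|I|} L^{χ(l'_a + E_V) - χ(l'_a + E_{J(a,I)})}] ∏ y_v^{a_v})`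
`· ∏_v (1-y_v)(1-Ly_v) = (L-1) · ∏_{{u,v} ∈ E(T)} (1 - y_u - y_v + L y_u y_v)`. -/
theorem tree_motivic_series_closed_formula {V : Type*} [Fintype V] [DecidableEq V]
    (T : SimpleGraph V) [DecidableRel T.Adj] (hT : T.IsTree)
    (B : V → V → ℤ)
    (hBsymm : ∀ u v, B u v = B v u)
    (hBadj : ∀ u v, T.Adj u v → B u v = 1)
    (hBnon : ∀ u v, u ≠ v → ¬ T.Adj u v → B u v = 0)
    (hposdef : ∀ x : V → ℚ, x ≠ 0 → pairQ B x x < 0)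
    (K : V → ℚ)
    (hK : ∀ v, pairQ B (K + basisVec v) (basisVec v) = -2)
    (lp : (V → ℕ) → (V → ℚ))
    (hlp : ∀ (a : V → ℕ) (v : V), pairQ B (lp a) (basisVec v) = -(a v : ℚ))
    (J : (V → ℕ) → Finset V → Finset V)
    (hJ : ∀ (a : V → ℕ) (I : Finset V), I ⊆ J a I ∧
      (∀ v ∉ J a I, pairQ B (basisVec v) (lp a + EJ (J a I)) ≤ 0) ∧
      ∀ J' : Finset V, I ⊆ J' →
        (∀ v ∉ J', pairQ B (basisVec v) (lp a + EJ J') ≤ 0) → J a I ⊆ J')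
    (eexp : (V → ℕ) → Finset V → ℤ)
    (heexp : ∀ (a : V → ℕ) (I : Finset V),
      (eexp a I : ℚ) = chiQ B K (lp a + EJ Finset.univ) - chiQ B K (lp a + EJ (J a I))) :
    (show MvPowerSeries V (LaurentPolynomial ℤ) from fun a =>
        ∑ I ∈ Finset.univ.powerset,
          (-1 : LaurentPolynomial ℤ) ^ I.card * LaurentPolynomial.T (eexp (fun v => a v) I)) *
      ∏ v : V, ((1 - MvPowerSeries.X v) *
        (1 - MvPowerSeries.C (σ := V) (R := LaurentPolynomial ℤ) (LaurentPolynomial.T 1) *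
          MvPowerSeries.X v)) =
    MvPowerSeries.C (σ := V) (R := LaurentPolynomial ℤ) (LaurentPolynomial.T 1 - 1) *
      ∏ e ∈ T.edgeFinset,
        Sym2.lift ⟨fun u v => 1 - MvPowerSeries.X u - MvPowerSeries.X v +
            MvPowerSeries.C (σ := V) (R := LaurentPolynomial ℤ) (LaurentPolynomial.T 1) *
              MvPowerSeries.X u * MvPowerSeries.X v,
          by intro u v; simp only []; ring⟩ e := by
  have hcl : ∀ a I, J a I = cl T univ a I := by
    intro a I
    have hc : ∀ J', (∀ v ∉ J', pairQ B (basisVec v) (lp a + EJ J') ≤ 0) ↔ Clo T univ a J' := by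
      intro J'
      unfold Clo
      refine forall_congr' fun v => ?_
      simp only [mem_univ, true_imp_iff]
      refine forall_congr' fun hv => ?_
      rw [pairQ_comm hBsymm, pairQ_add_left, hlp, pairQ_EJ_basis hBadj hBnon hBsymm, if_neg hv]
      rw [← Nat.cast_le (α := ℚ)]
      constructor <;> intro h <;> linarith
    obtain ⟨h1, h2, h3⟩ := hJ a I
    refine IsCl.unique ⟨h1, subset_univ _, (hc _).1 h2, ?_⟩ (isCl_cl a (subset_univ I))
    intro J' g1 _ g3
    exact h3 J' g1 ((hc _).2 g3)
  have hexp : ∀ a I, eexp a I = wt T a univ - wt T a (cl T univ a I) := by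
    intro a I
    have h := heexp a I
    rw [chi_eq hBadj hBnon hBsymm K hK (lp a) a (hlp a),
      chi_eq hBadj hBnon hBsymm K hK (lp a) a (hlp a), hcl] at h
    have h' : (eexp a I : ℚ) = ((wt T a univ - wt T a (cl T univ a I) : ℤ) : ℚ) := by
      rw [h]; push_cast; ring
    exact_mod_cast h'
  have hg := good_univ hT
  unfold Good at hg
  have hE : edgesIn T univ = T.edgeFinset := by
    unfold edgesIn
    exact filter_true_of_mem (by simp)
  rw [hE, ← prod_mul_distrib] at hg
  have hs : (show MvPowerSeries V (LaurentPolynomial ℤ) from fun a =>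
        ∑ I ∈ Finset.univ.powerset,
          (-1 : LaurentPolynomial ℤ) ^ I.card * LaurentPolynomial.T (eexp (fun v => a v) I)) =
      ser (FF T univ) := by
    funext a
    simp only [hexp]
    rfl
  have hR : (∏ e ∈ T.edgeFinset,
        Sym2.lift ⟨fun u v => 1 - MvPowerSeries.X u - MvPowerSeries.X v +
            MvPowerSeries.C (σ := V) (R := LaurentPolynomial ℤ) (LaurentPolynomial.T 1) *
              MvPowerSeries.X u * MvPowerSeries.X v,
          by intro u v; simp only []; ring⟩ e) = ∏ e ∈ T.edgeFinset, edgeF V e := by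
    refine prod_congr rfl fun e _ => ?_
    unfold edgeF
    rfl
  have hM : (∏ v : V, ((1 - MvPowerSeries.X v) *
        (1 - MvPowerSeries.C (σ := V) (R := LaurentPolynomial ℤ) (LaurentPolynomial.T 1) *
          MvPowerSeries.X v))) =
      ∏ v : V, ((1 - LL V * MvPowerSeries.X v) * (1 - MvPowerSeries.X v)) := by
    refine prod_congr rfl fun v _ => ?_
    unfold LL
    rw [mul_comm]
  have hC : MvPowerSeries.C (σ := V) (R := LaurentPolynomial ℤ) (LaurentPolynomial.T 1 - 1) =
      LL V - 1 := by
    unfold LL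
    rw [map_sub, map_one]
  rw [hR, hM, hC]
  exact (congrArg (· * _) hs).trans hg
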